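/- arXiv:1306.2137 — 2 statements merged into one kernel-verified Lean document; each statement's English description precedes it below -/
import Mathlib

section
/- Let W be a 2-dimensional complex vector space with a fixed basis and let M ∈ 𝒦(ℂ). Then for every K ∈ 𝒦(W) the function w ↦ ∫_{S¹} h(det(K,w), α) dS(M,α) on W is the support function of a convex body D̃_M K ∈ 𝒦(W*), and the map D̃_M : 𝒦(W) → 𝒦(W*) is a continuous, translation invariant, SL(W,ℂ)-contravariant Minkowski valuation which is homogeneous of degree 1 (i.e., D̃_M(λK) = λ D̃_M K for λ > 0). -/
open scoped Pointwise
open MeasureTheory Module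

noncomputable section

section CommonDefs

variable {V V' A : Type*}
variable [NormedAddCommGroup V] [NormedSpace ℝ V]
variable [NormedAddCommGroup V'] [NormedSpace ℝ V']
variable [NormedAddCommGroup A] [NormedSpace ℝ A]

/-- The supremum of a (pairing) functional over a convex body; used to express the
support function `h(K, ξ) = sup_{x ∈ K} ⟨ξ, x⟩` for the various pairings `p = ⟨ξ, ·⟩`. -/
def hSupp (K : ConvexBody V) (p : V → ℝ) : ℝ := sSup (p '' (K : Set V))

/-- The translate `x + K` of a convex body. -/
def ConvexBody.translate (K : ConvexBody V) (x : V) : ConvexBody V :=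
  ⟨(fun y => x + y) '' (K : Set V), K.convex.translate x,
    K.isCompact.image (continuous_const.add continuous_id),
    K.nonempty.image _⟩

/-- The image of a convex body under a continuous linear map. -/
def ConvexBody.mapCLM (f : V →L[ℝ] V') (K : ConvexBody V) : ConvexBody V' :=
  ⟨f '' (K : Set V), K.convex.linear_image (f : V →ₗ[ℝ] V'),
    K.isCompact.image f.continuous, K.nonempty.image _⟩

/-- The reflection `-K` of a convex body about the origin. -/
def ConvexBody.neg (K : ConvexBody V) : ConvexBody V :=
  K.mapCLM (-(ContinuousLinearMap.id ℝ V))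

/-- The union of two convex bodies (a convex body provided it is convex). -/
def ConvexBody.union (K L : ConvexBody V) (h : Convex ℝ ((K : Set V) ∪ (L : Set V))) :
    ConvexBody V :=
  ⟨(K : Set V) ∪ (L : Set V), h, K.isCompact.union L.isCompact,
    K.nonempty.mono Set.subset_union_left⟩

/-- The intersection of two convex bodies (a convex body provided it is nonempty). -/
def ConvexBody.inter (K L : ConvexBody V) (h : ((K : Set V) ∩ (L : Set V)).Nonempty) :
    ConvexBody V :=
  ⟨(K : Set V) ∩ (L : Set V), K.convex.inter L.convex,
    K.isCompact.inter_right L.isClosed, h⟩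

/-- A Minkowski valuation: `Z(K ∪ L) + Z(K ∩ L) = Z(K) + Z(L)` (Minkowski addition)
whenever `K, L, K ∪ L` are convex bodies. -/
def IsMinkowskiValuation (Z : ConvexBody V → ConvexBody A) : Prop :=
  ∀ (K L : ConvexBody V) (hU : Convex ℝ ((K : Set V) ∪ (L : Set V)))
    (hI : ((K : Set V) ∩ (L : Set V)).Nonempty),
    Z (K.union L hU) + Z (K.inter L hI) = Z K + Z L

/-- A real-valued valuation: `φ(K ∪ L) + φ(K ∩ L) = φ(K) + φ(L)`
whenever `K, L, K ∪ L` are convex bodies. -/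
def IsValuation (φ : ConvexBody V → ℝ) : Prop :=
  ∀ (K L : ConvexBody V) (hU : Convex ℝ ((K : Set V) ∪ (L : Set V)))
    (hI : ((K : Set V) ∩ (L : Set V)).Nonempty),
    φ (K.union L hU) + φ (K.inter L hI) = φ K + φ L

/-- Translation invariance of a map defined on convex bodies. -/
def IsTranslationInvariant {α : Type*} (Z : ConvexBody V → α) : Prop :=
  ∀ (K : ConvexBody V) (x : V), Z (K.translate x) = Z K

/-- The mixed volume (w.r.t. the Lebesgue (Haar) measure `μ`) of an `n`-tuple of convex
bodies, given by the polarization formula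
`V(K₁, …, Kₙ) = (1/n!) ∑_{S ⊆ {1,…,n}} (-1)^{n - |S|} vol(∑_{i ∈ S} K_i)`. -/
def mixedVol [MeasurableSpace V] (μ : Measure V) {n : ℕ} (K : Fin n → ConvexBody V) : ℝ :=
  (n.factorial : ℝ)⁻¹ *
    ∑ S : Finset (Fin n), (-1 : ℝ) ^ (n - S.card) * (μ (∑ i ∈ S, (K i : Set V))).toReal

/-- The extension `V(K, …, K, f)` (with `n - 1` copies of `K`) of the mixed volume to
continuous positively `1`-homogeneous functions `f` on the dual space, defined via
Aleksandrov's variational formula: `V(K,…,K,f)` is `1/n` times the right derivative at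
`t = 0` of the volume of the Wulff shape (aka Aleksandrov body) of `h_K + t f`.
For `f = h_L` the Wulff shape is `K + t L`, so this indeed extends `L ↦ V(K, …, K, L)`. -/
def mixedVolFn [MeasurableSpace V] (μ : Measure V) (K : ConvexBody V)
    (f : (V →L[ℝ] ℝ) → ℝ) : ℝ :=
  (Module.finrank ℝ V : ℝ)⁻¹ *
    derivWithin (fun t : ℝ =>
        (μ {x : V | ∀ ξ : V →L[ℝ] ℝ, ξ x ≤ hSupp K ξ + t * f ξ}).toReal)
      (Set.Ici 0) 0

/-- The dimension of a convex body: the dimension of (the direction of) its affine hull. -/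
def bodyDim (K : ConvexBody V) : ℕ := Module.finrank ℝ (vectorSpan ℝ (K : Set V))

/-- A convex body contained in a subspace `E`, viewed as a convex body of `E`. -/
def bodyIn (E : Submodule ℝ V) (K : ConvexBody V) (h : (K : Set V) ⊆ (E : Set V)) :
    ConvexBody ↥E :=
  ⟨Subtype.val ⁻¹' (K : Set V),
    K.convex.linear_preimage (E.subtype),
    by
      rw [Topology.IsEmbedding.subtypeVal.isCompact_iff,
        Set.image_preimage_eq_of_subset (by rw [Subtype.range_coe]; exact h)]
      exact K.isCompact,
    by obtain ⟨x, hx⟩ := K.nonempty; exact ⟨⟨x, h hx⟩, hx⟩⟩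

/-- The properties of the components of McMullen's decomposition of (the support function
of) a Minkowski valuation: each `fᵢ(·, u)` is a continuous, translation invariant
valuation, homogeneous of degree `i`, and each `fᵢ(K, ·)` is continuous and positively
`1`-homogeneous. -/
def McMullenProps (f : ℕ → ConvexBody V → V → ℝ) : Prop :=
  (∀ (i : ℕ) (u : V), Continuous fun K : ConvexBody V => f i K u) ∧
  (∀ (i : ℕ) (u : V), IsValuation fun K : ConvexBody V => f i K u) ∧
  (∀ (i : ℕ) (u : V), IsTranslationInvariant fun K : ConvexBody V => f i K u) ∧
  (∀ (i : ℕ) (K : ConvexBody V) (u : V) (t : ℝ), 0 < t → f i (t • K) u = t ^ i * f i K u) ∧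
  (∀ (i : ℕ) (K : ConvexBody V), Continuous fun u : V => f i K u) ∧
  (∀ (i : ℕ) (K : ConvexBody V) (u : V) (t : ℝ), 0 < t → f i K (t • u) = t * f i K u)

end CommonDefs

/-- The surface area measure `S(M, ·)` on `S¹ ⊆ ℂ` of a planar convex body `M`,
characterized (uniquely) by the property that it is a finite measure concentrated on the
unit circle with `∫_{S¹} h(L, α) dσ(α) = 2 V(M, L)` for every planar convex body `L`. -/
def IsSurfaceAreaMeasure (M : ConvexBody ℂ) (σ : Measure ℂ) : Prop :=
  IsFiniteMeasure σ ∧ σ (Metric.sphere (0 : ℂ) 1)ᶜ = 0 ∧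
    ∀ L : ConvexBody ℂ,
      (∫ α, hSupp L (fun c => (c * (starRingEnd ℂ) α).re) ∂σ) = 2 * mixedVol volume ![M, L]

section ComplexDefs

variable {W : Type*} [NormedAddCommGroup W] [NormedSpace ℂ W] [FiniteDimensional ℂ W]

/-- The determinant pairing `det(u, v)` on a 2-dimensional complex vector space,
with respect to a fixed basis `b`. -/
def cdet (b : Basis (Fin 2) ℂ W) (u v : W) : ℂ :=
  b.coord 0 u * b.coord 1 v - b.coord 1 u * b.coord 0 v

/-- `det(·, w) : W → ℂ` as a continuous real-linear map. -/
def cdetCLM (b : Basis (Fin 2) ℂ W) (w : W) : W →L[ℝ] ℂ :=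
  LinearMap.toContinuousLinearMap
    (((b.coord 1 w) • (b.coord 0 : W →ₗ[ℂ] ℂ)
      - (b.coord 0 w) • (b.coord 1 : W →ₗ[ℂ] ℂ)).restrictScalars ℝ)

/-- `det(K, w) = {det(k, w) : k ∈ K} ⊆ ℂ`. -/
def detBody (b : Basis (Fin 2) ℂ W) (K : ConvexBody W) (w : W) : ConvexBody ℂ :=
  K.mapCLM (cdetCLM b w)

/-- `N · w = {c • w : c ∈ N} ⊆ W` for a planar convex body `N ⊆ ℂ`. -/
def dotBody (N : ConvexBody ℂ) (w : W) : ConvexBody W :=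
  N.mapCLM (LinearMap.toContinuousLinearMap ((LinearMap.toSpanSingleton ℂ W w).restrictScalars ℝ))

/-- A complex-linear endomorphism, as a continuous real-linear map. -/
def cReal (g : W →ₗ[ℂ] W) : W →L[ℝ] W :=
  LinearMap.toContinuousLinearMap (g.restrictScalars ℝ)

/-- Precomposition `ξ ↦ ξ ∘ g` on the complex dual `W* = W →L[ℂ] ℂ`,
as a continuous real-linear map. The adjoint of `g` is `precompDual g`, and
`g^{-*} = precompDual g⁻¹`. -/
def precompDual (g : W →L[ℂ] W) : (W →L[ℂ] ℂ) →L[ℝ] (W →L[ℂ] ℂ) :=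
  LinearMap.toContinuousLinearMap
    { toFun := fun ξ => ξ.comp g
      map_add' := fun ξ η => ContinuousLinearMap.add_comp ξ η g
      map_smul' := fun r ξ => ContinuousLinearMap.smul_comp r ξ g }

/-- `Z : 𝒦(W) → 𝒦(W*)` is `SL(W,ℂ)`-contravariant: `Z(gK) = g^{-*} Z(K)` for every
`g ∈ SL(W,ℂ)`. -/
def IsSLContravariant (Z : ConvexBody W → ConvexBody (W →L[ℂ] ℂ)) : Prop :=
  ∀ g : W ≃L[ℂ] W, LinearMap.det ((g : W →L[ℂ] W) : W →ₗ[ℂ] W) = 1 →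
    ∀ K : ConvexBody W,
      Z (K.mapCLM (cReal (g : W →ₗ[ℂ] W))) =
        (Z K).mapCLM (precompDual (g.symm : W →L[ℂ] W))

/-- `Z : 𝒦(W) → 𝒦(W)` is `SL(W,ℂ)`-covariant: `Z(gK) = g Z(K)` for every
`g ∈ SL(W,ℂ)`. -/
def IsSLCovariant (Z : ConvexBody W → ConvexBody W) : Prop :=
  ∀ g : W ≃L[ℂ] W, LinearMap.det ((g : W →L[ℂ] W) : W →ₗ[ℂ] W) = 1 →
    ∀ K : ConvexBody W,
      Z (K.mapCLM (cReal (g : W →ₗ[ℂ] W))) = (Z K).mapCLM (cReal (g : W →ₗ[ℂ] W))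

end ComplexDefs

section SupportFunction

variable {V V' : Type*}
variable [NormedAddCommGroup V] [NormedSpace ℝ V]
variable [NormedAddCommGroup V'] [NormedSpace ℝ V']

lemma le_hSupp (K : ConvexBody V) {p : V → ℝ} (hp : Continuous p) {x : V} (hx : x ∈ K) :
    p x ≤ hSupp K p :=
  le_csSup (K.isCompact.image hp).bddAbove ⟨x, hx, rfl⟩

lemma hSupp_le (K : ConvexBody V) {p : V → ℝ} {c : ℝ} (h : ∀ x ∈ K, p x ≤ c) :
    hSupp K p ≤ c :=
  csSup_le (K.nonempty.image p) (by rintro _ ⟨x, hx, rfl⟩; exact h x hx)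

lemma exists_mem_eq_hSupp (K : ConvexBody V) {p : V → ℝ} (hp : Continuous p) :
    ∃ x ∈ K, p x = hSupp K p :=
  (K.isCompact.image hp).sSup_mem (K.nonempty.image p)

lemma hSupp_mapCLM (K : ConvexBody V) (f : V →L[ℝ] V') (p : V' → ℝ) :
    hSupp (K.mapCLM f) p = hSupp K (fun x => p (f x)) := by
  change sSup (p '' (f '' (K : Set V))) = _
  rw [Set.image_image]
  rfl

lemma hSupp_const_mul (K : ConvexBody V) {p : V → ℝ} {c : ℝ} (hc : 0 ≤ c) :
    hSupp K (fun x => c * p x) = c * hSupp K p := by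
  unfold hSupp
  rw [← smul_eq_mul, ← Real.sSup_smul_of_nonneg hc, ← Set.image_smul, Set.image_image]
  rfl

lemma hSupp_add_fun_le (K : ConvexBody V) {p q : V → ℝ} (hp : Continuous p)
    (hq : Continuous q) : hSupp K (fun x => p x + q x) ≤ hSupp K p + hSupp K q :=
  hSupp_le K fun _ hx => add_le_add (le_hSupp K hp hx) (le_hSupp K hq hx)

lemma hSupp_translate (K : ConvexBody V) (x : V) {p : V → ℝ} (hp : Continuous p)
    (hadd : ∀ y z, p (y + z) = p y + p z) :
    hSupp (K.translate x) p = hSupp K p + p x := by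
  apply le_antisymm
  · apply hSupp_le
    rintro _ ⟨y, hy, rfl⟩
    have := le_hSupp K hp hy
    simp only [hadd]
    linarith
  · obtain ⟨y, hy, h⟩ := exists_mem_eq_hSupp K hp
    rw [← h, add_comm, ← hadd]
    exact le_hSupp (K.translate x) hp ⟨y, hy, rfl⟩

lemma hSupp_add (K L : ConvexBody V) {p : V → ℝ} (hp : Continuous p)
    (hadd : ∀ y z, p (y + z) = p y + p z) :
    hSupp (K + L) p = hSupp K p + hSupp L p := by
  apply le_antisymm
  · apply hSupp_le
    rintro _ ⟨y, hy, z, hz, rfl⟩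
    simpa only [hadd] using add_le_add (le_hSupp K hp hy) (le_hSupp L hp hz)
  · obtain ⟨y, hy, h⟩ := exists_mem_eq_hSupp K hp
    obtain ⟨z, hz, h'⟩ := exists_mem_eq_hSupp L hp
    rw [← h, ← h', ← hadd]
    exact le_hSupp (K + L) hp ⟨y, hy, z, hz, rfl⟩

lemma hSupp_smul (K : ConvexBody V) {c : ℝ} (hc : 0 ≤ c) {p : V → ℝ}
    (hsmul : ∀ y, p (c • y) = c * p y) :
    hSupp (c • K) p = c * hSupp K p := by
  rw [← hSupp_const_mul K hc]
  unfold hSupp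
  rw [ConvexBody.coe_smul, ← Set.image_smul, Set.image_image]
  simp only [hsmul]

/-- On a convex union of two convex bodies, the maximum and minimum of the two support values
are attained on the union and the intersection, respectively. -/
lemma hSupp_union_add_inter (K L : ConvexBody V)
    (hU : Convex ℝ ((K : Set V) ∪ (L : Set V)))
    (hI : ((K : Set V) ∩ (L : Set V)).Nonempty) (p : V →L[ℝ] ℝ) :
    hSupp (K.union L hU) p + hSupp (K.inter L hI) p = hSupp K p + hSupp L p := by
  have hp := p.continuous
  have hunion : hSupp (K.union L hU) p = max (hSupp K p) (hSupp L p) := by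
    apply le_antisymm
    · apply hSupp_le
      rintro x (hx | hx)
      · exact le_max_of_le_left (le_hSupp K hp hx)
      · exact le_max_of_le_right (le_hSupp L hp hx)
    · apply max_le
      · exact hSupp_le K fun x hx => le_hSupp (K.union L hU) hp (Or.inl hx)
      · exact hSupp_le L fun x hx => le_hSupp (K.union L hU) hp (Or.inr hx)
  have hinter : hSupp (K.inter L hI) p = min (hSupp K p) (hSupp L p) := by
    apply le_antisymm
    · exact hSupp_le _ fun x hx => le_min (le_hSupp K hp hx.1) (le_hSupp L hp hx.2)
    · obtain ⟨k, hk, hkp⟩ := exists_mem_eq_hSupp K hp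
      obtain ⟨l, hl, hlp⟩ := exists_mem_eq_hSupp L hp
      have hsub : segment ℝ k l ⊆ (K : Set V) ∪ (L : Set V) :=
        hU.segment_subset (Or.inl hk) (Or.inr hl)
      obtain ⟨x, hxs, hx⟩ := isPreconnected_closed_iff.1 (convex_segment k l).isPreconnected
        (K : Set V) (L : Set V) K.isClosed L.isClosed hsub
        ⟨k, left_mem_segment ℝ k l, hk⟩ ⟨l, right_mem_segment ℝ k l, hl⟩
      refine le_trans ?_ (le_hSupp (K.inter L hI) hp hx)
      rw [← hkp, ← hlp]
      obtain ⟨s, t, hs, ht, hst, rfl⟩ := hxs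
      simp only [map_add, map_smul, smul_eq_mul]
      calc min (p k) (p l) = s * min (p k) (p l) + t * min (p k) (p l) := by
            rw [← add_mul, hst, one_mul]
        _ ≤ _ := add_le_add (mul_le_mul_of_nonneg_left (min_le_left _ _) hs)
            (mul_le_mul_of_nonneg_left (min_le_right _ _) ht)
  rw [hunion, hinter, max_add_min]

end SupportFunction

section DualBodies

variable {W : Type*} [NormedAddCommGroup W] [NormedSpace ℂ W]

lemma continuous_re_apply (w : W) : Continuous fun ξ : W →L[ℂ] ℂ => (ξ w).re :=
  Complex.continuous_re.comp (continuous_eval_const w)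

variable [FiniteDimensional ℂ W]

lemma exists_eval_eq (f : StrongDual ℂ (W →L[ℂ] ℂ)) : ∃ w : W, ∀ ξ, f ξ = ξ w := by
  refine ⟨(Module.evalEquiv ℂ W).symm
    ((f : (W →L[ℂ] ℂ) →ₗ[ℂ] ℂ) ∘ₗ (LinearMap.toContinuousLinearMap :
      (W →ₗ[ℂ] ℂ) ≃ₗ[ℂ] W →L[ℂ] ℂ).toLinearMap), fun ξ => ?_⟩
  have := Module.apply_evalEquiv_symm_apply ℂ W (ξ : W →ₗ[ℂ] ℂ)
    ((f : (W →L[ℂ] ℂ) →ₗ[ℂ] ℂ) ∘ₗ (LinearMap.toContinuousLinearMap :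
      (W →ₗ[ℂ] ℂ) ≃ₗ[ℂ] W →L[ℂ] ℂ).toLinearMap)
  exact this.symm

lemma exists_mem_dist_le_of_hSupp_le (L₁ L₂ : ConvexBody (W →L[ℂ] ℂ)) {ε : ℝ} (hε : 0 ≤ ε)
    (h : ∀ w : W, hSupp L₁ (fun ξ => (ξ w).re) ≤ hSupp L₂ (fun ξ => (ξ w).re) + ε * ‖w‖)
    {ξ : W →L[ℂ] ℂ} (hξ : ξ ∈ L₁) : ∃ η ∈ L₂, dist ξ η ≤ ε := by
  have : ProperSpace (W →L[ℂ] ℂ) := FiniteDimensional.proper ℂ _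
  let B : ConvexBody (W →L[ℂ] ℂ) := ⟨Metric.closedBall 0 ε, convex_closedBall _ _,
    isCompact_closedBall _ _, ⟨0, Metric.mem_closedBall_self hε⟩⟩
  suffices hmem : ξ ∈ L₂ + B by
    obtain ⟨η, hη, ζ, hζ, rfl⟩ := hmem
    refine ⟨η, hη, ?_⟩
    have hζ' : ζ ∈ Metric.closedBall 0 ε := hζ
    simpa [dist_eq_norm] using hζ'
  by_contra hmem
  obtain ⟨f, u, hf, hu⟩ := RCLike.geometric_hahn_banach_closed_point (𝕜 := ℂ)
    (L₂ + B).convex (L₂ + B).isClosed hmem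
  obtain ⟨w, hw⟩ := exists_eval_eq f
  simp only [hw, RCLike.re_eq_complex_re] at hf hu
  have hξw := le_hSupp L₁ (continuous_re_apply w) hξ
  obtain ⟨η, hη, hηw⟩ := exists_mem_eq_hSupp L₂ (continuous_re_apply w)
  obtain ⟨g, hg, hgw⟩ := exists_dual_vector'' ℂ w
  have hgB : (ε : ℂ) • g ∈ B := by
    change _ ∈ Metric.closedBall _ _
    rw [mem_closedBall_zero_iff, norm_smul, Complex.norm_real, Real.norm_of_nonneg hε]
    exact mul_le_of_le_one_right hε hg
  have := hf _ (Set.add_mem_add hη hgB)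
  simp [hgw] at this
  have := h w
  linarith

lemma dist_le_of_hSupp_le (L₁ L₂ : ConvexBody (W →L[ℂ] ℂ)) {ε : ℝ} (hε : 0 ≤ ε)
    (h₁ : ∀ w : W, hSupp L₁ (fun ξ => (ξ w).re) ≤ hSupp L₂ (fun ξ => (ξ w).re) + ε * ‖w‖)
    (h₂ : ∀ w : W, hSupp L₂ (fun ξ => (ξ w).re) ≤ hSupp L₁ (fun ξ => (ξ w).re) + ε * ‖w‖) :
    dist L₁ L₂ ≤ ε :=
  Metric.hausdorffDist_le_of_mem_dist hε
    (fun _ hξ => exists_mem_dist_le_of_hSupp_le L₁ L₂ hε h₁ hξ)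
    (fun _ hξ => exists_mem_dist_le_of_hSupp_le L₂ L₁ hε h₂ hξ)

lemma eq_of_hSupp_eq {L₁ L₂ : ConvexBody (W →L[ℂ] ℂ)}
    (h : ∀ w : W, hSupp L₁ (fun ξ => (ξ w).re) = hSupp L₂ (fun ξ => (ξ w).re)) : L₁ = L₂ :=
  dist_le_zero.1 <| dist_le_of_hSupp_le L₁ L₂ le_rfl (fun w => by simp [h w])
    (fun w => by simp [h w])

/-- A sublinear function on `W` is the support function of a convex body in `W*`. -/
lemma exists_convexBody_hSupp_eq (p : W → ℝ) {C : ℝ}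
    (hom : ∀ c : ℝ, 0 < c → ∀ w, p (c • w) = c * p w)
    (subadd : ∀ v w, p (v + w) ≤ p v + p w) (bound : ∀ w, p w ≤ C * ‖w‖) :
    ∃ L : ConvexBody (W →L[ℂ] ℂ), ∀ w, hSupp L (fun ξ => (ξ w).re) = p w := by
  have : ProperSpace (W →L[ℂ] ℂ) := FiniteDimensional.proper ℂ _
  have p0 : p 0 = 0 := by
    have := hom 2 (by norm_num) 0
    rw [smul_zero] at this
    linarith
  have touch : ∀ w₀, ∃ ξ : W →L[ℂ] ℂ, (∀ w, (ξ w).re ≤ p w) ∧ (ξ w₀).re = p w₀ := by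
    intro w₀
    let f : W →ₗ.[ℝ] ℝ := LinearPMap.mkSpanSingleton' w₀ (p w₀) fun c hc => by
      rcases smul_eq_zero.1 hc with rfl | rfl
      · simp
      · simp [p0]
    obtain ⟨g, hgf, hgp⟩ := exists_extension_of_le_sublinear f p hom subadd (by
      rintro ⟨x, hx⟩
      obtain ⟨c, rfl⟩ := Submodule.mem_span_singleton.1 hx
      have hfc : f ⟨c • w₀, hx⟩ = c * p w₀ :=
        LinearPMap.mkSpanSingleton'_apply w₀ (p w₀) _ c hx
      rw [hfc]
      rcases lt_trichotomy c 0 with hc | rfl | hc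
      · have h₁ := hom (-c) (by linarith) w₀
        have h₂ := subadd (c • w₀) ((-c) • w₀)
        rw [← add_smul, add_neg_cancel, zero_smul, p0] at h₂
        simp only
        linarith
      · simp [p0]
      · exact (hom c hc w₀).ge)
    refine ⟨LinearMap.toContinuousLinearMap (Module.Dual.extendRCLike (𝕜 := ℂ) g),
      fun w => ?_, ?_⟩
    · have := Module.Dual.re_extendRCLike_apply (𝕜 := ℂ) g w
      exact this.le.trans (hgp w)
    · refine (Module.Dual.re_extendRCLike_apply (𝕜 := ℂ) g w₀).trans ?_
      refine (hgf ⟨w₀, Submodule.mem_span_singleton_self w₀⟩).trans ?_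
      exact LinearPMap.mkSpanSingleton'_apply_self w₀ (p w₀) _ _
  have hC : ∀ w : W, 0 ≤ C * ‖w‖ := fun w => by
    have h₁ := subadd w (-w)
    rw [add_neg_cancel, p0] at h₁
    have h₂ := bound w
    have h₃ := bound (-w)
    rw [norm_neg] at h₃
    linarith
  let L : ConvexBody (W →L[ℂ] ℂ) :=
    { carrier := {ξ | ∀ w, (ξ w).re ≤ p w}
      convex' := by
        intro ξ hξ η hη s t hs ht hst w
        have h₁ := mul_le_mul_of_nonneg_left (hξ w) hs
        have h₂ := mul_le_mul_of_nonneg_left (hη w) ht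
        have h₃ : s * p w + t * p w = p w := by rw [← add_mul, hst, one_mul]
        simp
        linarith
      isCompact' := by
        refine Metric.isCompact_of_isClosed_isBounded ?_ ?_
        · rw [Set.ofPred_forall]
          exact isClosed_iInter fun w => isClosed_le (continuous_re_apply w) continuous_const
        · refine (Metric.isBounded_closedBall (x := (0 : W →L[ℂ] ℂ)) (r := max C 0)).subset ?_
          intro ξ hξ
          rw [mem_closedBall_zero_iff]
          refine ξ.opNorm_le_bound (le_max_right _ _) fun w => ?_
          refine le_trans ?_ (mul_le_mul_of_nonneg_right (le_max_left C 0) (norm_nonneg w))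
          by_cases h0 : ξ w = 0
          · rw [h0, norm_zero]
            exact hC w
          have hn : ‖ξ w‖ ≠ 0 := norm_ne_zero_iff.2 h0
          let u : ℂ := (starRingEnd ℂ) (ξ w) / ‖ξ w‖
          have hu : ‖u‖ = 1 := by simp [u, hn]
          have hre : (ξ (u • w)).re = ‖ξ w‖ := by
            have : ξ (u • w) = ‖ξ w‖ := by
              rw [map_smul, smul_eq_mul, div_mul_eq_mul_div, mul_comm, Complex.mul_conj,
                Complex.normSq_eq_norm_sq]
              push_cast
              field_simp
            rw [this, Complex.ofReal_re]
          calc ‖ξ w‖ = (ξ (u • w)).re := hre.symm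
            _ ≤ p (u • w) := hξ _
            _ ≤ C * ‖u • w‖ := bound _
            _ = C * ‖w‖ := by rw [norm_smul, hu, one_mul]
      nonempty' := (touch 0).imp fun _ h => h.1 }
  refine ⟨L, fun w => le_antisymm (hSupp_le L fun ξ hξ => hξ w) ?_⟩
  obtain ⟨ξ, hξ, hξw⟩ := touch w
  rw [← hξw]
  exact le_hSupp L (continuous_re_apply w) hξ

end DualBodies

section PlanarIntegral

/-- The real-linear functional `c ↦ Re (c * conj α)` on `ℂ`. -/
def reMulConj (α : ℂ) : ℂ →L[ℝ] ℝ :=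
  Complex.reCLM ∘L (ContinuousLinearMap.mul ℝ ℂ).flip ((starRingEnd ℂ) α)

lemma reMulConj_apply (α c : ℂ) : reMulConj α c = (c * (starRingEnd ℂ) α).re := rfl

lemma abs_reMulConj_le (α c : ℂ) : |reMulConj α c| ≤ ‖c‖ * ‖α‖ := by
  rw [reMulConj_apply]
  exact (Complex.abs_re_le_norm _).trans (by simp)

lemma reMulConj_sub (α β c : ℂ) : reMulConj α c - reMulConj β c = reMulConj (α - β) c := by
  simp [reMulConj_apply]
  ring

lemma hSupp_le_hSupp_add (N : ConvexBody ℂ) {R : ℝ} (hR : ∀ c ∈ N, ‖c‖ ≤ R) (α β : ℂ) :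
    hSupp N (reMulConj α) ≤ hSupp N (reMulConj β) + R * dist α β := by
  refine hSupp_le N fun c hc => ?_
  have h₁ := le_hSupp N (reMulConj β).continuous hc
  have h₂ := (le_abs_self _).trans (abs_reMulConj_le (α - β) c)
  rw [← reMulConj_sub, ← dist_eq_norm] at h₂
  have h₃ := mul_le_mul_of_nonneg_right (hR c hc) (dist_nonneg (x := α) (y := β))
  linarith

lemma continuous_hSupp_reMulConj (N : ConvexBody ℂ) :
    Continuous fun α => hSupp N (reMulConj α) := by
  obtain ⟨R, hR0, hR⟩ := N.isBounded.exists_pos_norm_le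
  exact (LipschitzWith.of_le_add_mul R.toNNReal fun α β => by
    rw [Real.coe_toNNReal R hR0.le]
    exact hSupp_le_hSupp_add N hR α β).continuous

variable {σ : Measure ℂ}

lemma ae_norm_eq_one (hS : σ (Metric.sphere (0 : ℂ) 1)ᶜ = 0) : ∀ᵐ α ∂σ, ‖α‖ = 1 := by
  rw [ae_iff]
  convert hS using 2
  ext α
  simp

lemma integrable_hSupp [IsFiniteMeasure σ] (hS : σ (Metric.sphere (0 : ℂ) 1)ᶜ = 0)
    (N : ConvexBody ℂ) : Integrable (fun α => hSupp N (reMulConj α)) σ := by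
  obtain ⟨R, hR0, hR⟩ := N.isBounded.exists_pos_norm_le
  refine Integrable.of_bound (continuous_hSupp_reMulConj N).aestronglyMeasurable R ?_
  filter_upwards [ae_norm_eq_one hS] with α hα
  obtain ⟨c, hc, h⟩ := exists_mem_eq_hSupp N (reMulConj α).continuous
  rw [← h, Real.norm_eq_abs]
  refine (abs_reMulConj_le α c).trans ?_
  rw [hα, mul_one]
  exact hR c hc

/-- The convex body consisting of a single point. -/
def pointBody (z : ℂ) : ConvexBody ℂ :=
  ⟨{z}, convex_singleton z, isCompact_singleton, Set.singleton_nonempty z⟩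

lemma hSupp_pointBody (z : ℂ) (p : ℂ → ℝ) : hSupp (pointBody z) p = p z := by
  change sSup (p '' {z}) = _
  rw [Set.image_singleton, csSup_singleton]

lemma mixedVol_pointBody (M : ConvexBody ℂ) (z : ℂ) :
    mixedVol volume ![M, pointBody z] = 0 := by
  have huniv : (Finset.univ : Finset (Finset (Fin 2))) = {∅, {0}, {1}, {0, 1}} := by decide
  have hz : ((pointBody z : ConvexBody ℂ) : Set ℂ) = {z} := rfl
  have h0 : volume (0 : Set ℂ) = 0 := by rw [← Set.singleton_zero, measure_singleton]
  unfold mixedVol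
  rw [huniv, Finset.sum_insert (by decide), Finset.sum_insert (by decide),
    Finset.sum_insert (by decide), Finset.sum_singleton]
  simp [hz, h0]

lemma integral_reMulConj_eq_zero {M : ConvexBody ℂ} (hσ : IsSurfaceAreaMeasure M σ) (z : ℂ) :
    ∫ α, reMulConj α z ∂σ = 0 := by
  have := hσ.2.2 (pointBody z)
  rw [mixedVol_pointBody, mul_zero] at this
  rw [← this]
  exact integral_congr_ae (.of_forall fun α => (hSupp_pointBody z (reMulConj α)).symm)

end PlanarIntegral

section Determinant

variable {W : Type*} [NormedAddCommGroup W] [NormedSpace ℂ W]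
variable (b : Basis (Fin 2) ℂ W)

lemma cdet_eq_det (u v : W) : cdet b u v = b.det ![u, v] := by
  simp [cdet, Basis.det_apply, Matrix.det_fin_two, Basis.toMatrix_apply]
  ring

lemma cdet_map_map (g : W →ₗ[ℂ] W) (u v : W) :
    cdet b (g u) (g v) = LinearMap.det g * cdet b u v := by
  rw [cdet_eq_det, cdet_eq_det, ← Basis.det_comp]
  congr 1
  ext i
  fin_cases i <;> rfl

lemma cdet_add_right (u v w : W) : cdet b u (v + w) = cdet b u v + cdet b u w := by
  simp [cdet]
  ring

lemma cdet_smul_right (c : ℝ) (u w : W) : cdet b u (c • w) = c * cdet b u w := by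
  rw [← Complex.coe_smul]
  simp [cdet]
  ring

variable [FiniteDimensional ℂ W]

lemma cdetCLM_apply (u w : W) : cdetCLM b w u = cdet b u w := by
  simp [cdetCLM, cdet]
  ring

lemma exists_norm_cdet_le : ∃ C : ℝ, 0 ≤ C ∧ ∀ u w, ‖cdet b u w‖ ≤ C * ‖u‖ * ‖w‖ := by
  let f (i : Fin 2) : W →L[ℂ] ℂ := LinearMap.toContinuousLinearMap (b.coord i)
  refine ⟨2 * ‖f 0‖ * ‖f 1‖, by positivity, fun u w => ?_⟩
  calc ‖cdet b u w‖ = ‖f 0 u * f 1 w - f 1 u * f 0 w‖ := rfl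
    _ ≤ ‖f 0 u‖ * ‖f 1 w‖ + ‖f 1 u‖ * ‖f 0 w‖ := by
      simpa only [norm_mul] using norm_sub_le (f 0 u * f 1 w) (f 1 u * f 0 w)
    _ ≤ (‖f 0‖ * ‖u‖) * (‖f 1‖ * ‖w‖) + (‖f 1‖ * ‖u‖) * (‖f 0‖ * ‖w‖) := by
      gcongr <;> exact ContinuousLinearMap.le_opNorm _ _
    _ = _ := by ring

/-- The real-linear functional `k ↦ Re (det(k, w) * conj α)` on `W`. -/
def detFunctional (w : W) (α : ℂ) : W →L[ℝ] ℝ := reMulConj α ∘L cdetCLM b w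

lemma detFunctional_apply (u w : W) (α : ℂ) :
    detFunctional b w α u = reMulConj α (cdet b u w) := by
  rw [← cdetCLM_apply]
  rfl

lemma hSupp_detBody (K : ConvexBody W) (w : W) (α : ℂ) :
    hSupp (detBody b K w) (reMulConj α) = hSupp K (detFunctional b w α) :=
  hSupp_mapCLM K _ _

/-- The function `w ↦ ∫ h(det(K, w), α) dσ(α)`. -/
def detSupport (σ : Measure ℂ) (K : ConvexBody W) (w : W) : ℝ :=
  ∫ α, hSupp K (detFunctional b w α) ∂σ

lemma detSupport_eq (σ : Measure ℂ) (K : ConvexBody W) (w : W) :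
    ∫ α, hSupp (detBody b K w) (fun c => (c * (starRingEnd ℂ) α).re) ∂σ =
      detSupport b σ K w :=
  integral_congr_ae (.of_forall fun α => hSupp_detBody b K w α)

variable {σ : Measure ℂ}

lemma integrable_detFunctional [IsFiniteMeasure σ] (hS : σ (Metric.sphere (0 : ℂ) 1)ᶜ = 0)
    (K : ConvexBody W) (w : W) : Integrable (fun α => hSupp K (detFunctional b w α)) σ := by
  simpa only [hSupp_detBody] using integrable_hSupp hS (detBody b K w)

lemma detSupport_real_smul (K : ConvexBody W) {c : ℝ} (hc : 0 ≤ c) (w : W) :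
    detSupport b σ K (c • w) = c * detSupport b σ K w := by
  unfold detSupport
  rw [← integral_const_mul]
  congr 1 with α
  rw [← hSupp_const_mul K hc]
  congr 1 with u
  simp [detFunctional_apply, cdet_smul_right, reMulConj_apply, mul_assoc]

lemma detSupport_add_le [IsFiniteMeasure σ] (hS : σ (Metric.sphere (0 : ℂ) 1)ᶜ = 0)
    (K : ConvexBody W) (v w : W) :
    detSupport b σ K (v + w) ≤ detSupport b σ K v + detSupport b σ K w := by
  unfold detSupport
  rw [← integral_add (integrable_detFunctional b hS K v) (integrable_detFunctional b hS K w)]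
  refine integral_mono (integrable_detFunctional b hS K _)
    ((integrable_detFunctional b hS K v).add (integrable_detFunctional b hS K w)) fun α => ?_
  have h : ⇑(detFunctional b (v + w) α) =
      fun u => detFunctional b v α u + detFunctional b w α u := by
    ext u
    simp only [detFunctional_apply, cdet_add_right, map_add]
  simp only [h]
  exact hSupp_add_fun_le K (detFunctional b v α).continuous (detFunctional b w α).continuous

lemma detSupport_le_add [IsFiniteMeasure σ] (hS : σ (Metric.sphere (0 : ℂ) 1)ᶜ = 0)
    {C : ℝ} (hC : 0 ≤ C) (hdet : ∀ u w, ‖cdet b u w‖ ≤ C * ‖u‖ * ‖w‖)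
    {K K' : ConvexBody W} {δ : ℝ}
    (hK : ∀ x ∈ K, ∃ y ∈ K', dist x y ≤ δ) (w : W) :
    detSupport b σ K w ≤ detSupport b σ K' w + σ.real Set.univ * C * δ * ‖w‖ := by
  have hconst : σ.real Set.univ * C * δ * ‖w‖ = ∫ _, C * δ * ‖w‖ ∂σ := by
    rw [integral_const, smul_eq_mul]
    ring
  unfold detSupport
  rw [hconst, ← integral_add (integrable_detFunctional b hS K' w) (integrable_const _)]
  refine integral_mono_ae (integrable_detFunctional b hS K w)
    ((integrable_detFunctional b hS K' w).add (integrable_const _)) ?_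
  filter_upwards [ae_norm_eq_one hS] with α hα
  refine hSupp_le K fun x hx => ?_
  obtain ⟨y, hy, hxy⟩ := hK x hx
  have h₁ := le_hSupp K' (detFunctional b w α).continuous hy
  have h₂ : detFunctional b w α (x - y) ≤ C * δ * ‖w‖ := by
    rw [detFunctional_apply]
    refine (le_abs_self _).trans ((abs_reMulConj_le _ _).trans ?_)
    rw [hα, mul_one]
    refine (hdet _ _).trans ?_
    rw [← dist_eq_norm]
    gcongr
  rw [map_sub] at h₂
  linarith

lemma detSupport_zero (w : W) : detSupport b σ (0 : ConvexBody W) w = 0 := by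
  have h : ∀ f : W →L[ℝ] ℝ, hSupp (0 : ConvexBody W) f = 0 := fun f => by
    simp [hSupp, ← Set.singleton_zero]
  simp [detSupport, h]

lemma exists_detSupport_le [IsFiniteMeasure σ] (hS : σ (Metric.sphere (0 : ℂ) 1)ᶜ = 0)
    (K : ConvexBody W) : ∃ C : ℝ, ∀ w, detSupport b σ K w ≤ C * ‖w‖ := by
  obtain ⟨C, hC, hdet⟩ := exists_norm_cdet_le b
  obtain ⟨R, -, hR⟩ := K.isBounded.exists_pos_norm_le
  refine ⟨σ.real Set.univ * C * R, fun w => ?_⟩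
  simpa only [detSupport_zero, zero_add] using
    detSupport_le_add b hS hC hdet (K := K) (K' := 0) (δ := R)
      (fun x hx => ⟨0, rfl, by simpa using hR x hx⟩) w

lemma detSupport_translate {M : ConvexBody ℂ} (hσ : IsSurfaceAreaMeasure M σ)
    (K : ConvexBody W) (x w : W) :
    detSupport b σ (K.translate x) w = detSupport b σ K w := by
  have := hσ.1
  have hpoint : Integrable (fun α => reMulConj α (cdet b x w)) σ := by
    simpa only [hSupp_pointBody] using integrable_hSupp hσ.2.1 (pointBody (cdet b x w))
  unfold detSupport
  simp only [hSupp_translate K x (detFunctional b w _).continuous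
    (map_add (detFunctional b w _)), detFunctional_apply]
  rw [integral_add (integrable_detFunctional b hσ.2.1 K w) hpoint,
    integral_reMulConj_eq_zero hσ, add_zero]

lemma detSupport_union_add_inter [IsFiniteMeasure σ]
    (hS : σ (Metric.sphere (0 : ℂ) 1)ᶜ = 0) (K L : ConvexBody W)
    (hU : Convex ℝ ((K : Set W) ∪ (L : Set W)))
    (hI : ((K : Set W) ∩ (L : Set W)).Nonempty) (w : W) :
    detSupport b σ (K.union L hU) w + detSupport b σ (K.inter L hI) w =
      detSupport b σ K w + detSupport b σ L w := by
  have hint := fun K' : ConvexBody W => integrable_detFunctional b hS K' w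
  unfold detSupport
  rw [← integral_add (hint _) (hint _), ← integral_add (hint _) (hint _)]
  simp only [hSupp_union_add_inter]

lemma detSupport_map (g : W ≃L[ℂ] W)
    (hg : LinearMap.det ((g : W →L[ℂ] W) : W →ₗ[ℂ] W) = 1) (K : ConvexBody W) (w : W) :
    detSupport b σ (K.mapCLM (cReal (g : W →ₗ[ℂ] W))) w =
      detSupport b σ K (g.symm w) := by
  unfold detSupport
  congr 1 with α
  rw [hSupp_mapCLM]
  congr 1 with u
  rw [detFunctional_apply, detFunctional_apply]
  have := cdet_map_map b ((g : W →L[ℂ] W) : W →ₗ[ℂ] W) u (g.symm w)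
  rw [hg, one_mul] at this
  rw [← this]
  simp [cReal]

lemma detSupport_smul (K : ConvexBody W) {c : ℝ} (hc : 0 ≤ c) (w : W) :
    detSupport b σ (c • K) w = c * detSupport b σ K w := by
  unfold detSupport
  rw [← integral_const_mul]
  congr 1 with α
  exact hSupp_smul K hc fun y => by rw [map_smul, smul_eq_mul]

end Determinant

/-- Let `W` be a 2-dimensional complex vector space with a fixed basis
`b`, let `M ∈ 𝒦(ℂ)` and let `σ = S(M,·)` be its surface area measure. Then for every
`K ∈ 𝒦(W)` the function `w ↦ ∫_{S¹} h(det(K,w), α) dS(M, α)` is the support function of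
a convex body `D̃_M K ∈ 𝒦(W*)`, and the map `D̃_M : 𝒦(W) → 𝒦(W*)` so defined is a
continuous, translation invariant, `SL(W,ℂ)`-contravariant Minkowski valuation which is
homogeneous of degree `1`, i.e. `D̃_M (λ K) = λ D̃_M K` for `λ > 0`. -/
theorem tildeD_is_contravariant_valuation
    {W : Type*} [NormedAddCommGroup W] [NormedSpace ℂ W] [FiniteDimensional ℂ W]
    (hW : Module.finrank ℂ W = 2) (b : Basis (Fin 2) ℂ W)
    (M : ConvexBody ℂ) (σ : Measure ℂ) (hσ : IsSurfaceAreaMeasure M σ) :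
    (∀ K : ConvexBody W, ∃ L : ConvexBody (W →L[ℂ] ℂ), ∀ w : W,
      hSupp L (fun ξ => (ξ w).re) =
        ∫ α, hSupp (detBody b K w) (fun c => (c * (starRingEnd ℂ) α).re) ∂σ) ∧
    (∀ D : ConvexBody W → ConvexBody (W →L[ℂ] ℂ),
      (∀ (K : ConvexBody W) (w : W),
        hSupp (D K) (fun ξ => (ξ w).re) =
          ∫ α, hSupp (detBody b K w) (fun c => (c * (starRingEnd ℂ) α).re) ∂σ) →
      Continuous D ∧ IsTranslationInvariant D ∧ IsMinkowskiValuation D ∧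
        IsSLContravariant D ∧
        ∀ (K : ConvexBody W) (l : ℝ), 0 < l → D (l • K) = l • D K) := by
  have hfin := hσ.1
  have hS := hσ.2.1
  simp only [detSupport_eq]
  refine ⟨fun K => ?_, fun D hD => ⟨?_, fun K x => ?_, fun K L hU hI => ?_,
    fun g hg K => ?_, fun K l hl => ?_⟩⟩
  · obtain ⟨C, hC⟩ := exists_detSupport_le b hS K
    exact exists_convexBody_hSupp_eq _ (fun c hc w => detSupport_real_smul b K hc.le w)
      (detSupport_add_le b hS K) hC
  · obtain ⟨C, hC, hdet⟩ := exists_norm_cdet_le b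
    have hA : 0 ≤ σ.real Set.univ * C := mul_nonneg measureReal_nonneg hC
    refine (LipschitzWith.of_dist_le_mul (K := (σ.real Set.univ * C).toNNReal)
      fun K K' => ?_).continuous
    rw [Real.coe_toNNReal _ hA]
    have near : ∀ (K K' : ConvexBody W), ∀ x ∈ K, ∃ y ∈ K', dist x y ≤ dist K K' := by
      intro K K' x hx
      obtain ⟨y, hy, hxy⟩ := K'.isCompact.exists_infDist_eq_dist K'.nonempty x
      exact ⟨y, hy, hxy ▸ Metric.infDist_le_hausdorffDist_of_mem hx
        ConvexBody.hausdorffEDist_ne_top⟩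
    refine dist_le_of_hSupp_le _ _ (mul_nonneg hA dist_nonneg) (fun w => ?_) (fun w => ?_)
    · rw [hD, hD]
      exact detSupport_le_add b hS hC hdet (near K K') w
    · rw [hD, hD, dist_comm]
      exact detSupport_le_add b hS hC hdet (near K' K) w
  · exact eq_of_hSupp_eq fun w => by rw [hD, hD, detSupport_translate b hσ]
  · refine eq_of_hSupp_eq fun w => ?_
    rw [hSupp_add _ _ (continuous_re_apply w) (by simp),
      hSupp_add _ _ (continuous_re_apply w) (by simp), hD, hD, hD, hD,
      detSupport_union_add_inter b hS]
  · refine eq_of_hSupp_eq fun w => ?_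
    rw [hD, hSupp_mapCLM, detSupport_map b g hg, ← hD]
    rfl
  · refine eq_of_hSupp_eq fun w => ?_
    rw [hD, hSupp_smul (D K) hl.le (by simp), hD, detSupport_smul b K hl.le]
end
end

section
/- Let W be a 2-dimensional complex vector space, Z : 𝒦(W) → 𝒦(W*) a continuous, translation invariant, SL(W,ℂ)-contravariant Minkowski valuation, and f_2 its McMullen component of degree 2. Then f_2 : 𝒦(W) × W → ℝ is continuous and satisfies f_2(gK, u) = (det_ℂ g)^{3/2} f_2(K, g⁻¹u) for every g ∈ GL(W,ℂ) whose complex determinant det_ℂ g is a positive real number, every K ∈ 𝒦(W) and every u ∈ W. -/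
open scoped Pointwise
open MeasureTheory Module

noncomputable section

section SupportFunction

variable {W : Type*} [NormedAddCommGroup W] [NormedSpace ℂ W]

theorem bddAbove_image_re_apply (A : ConvexBody (W →L[ℂ] ℂ)) (u : W) :
    BddAbove ((fun ξ : W →L[ℂ] ℂ => (ξ u).re) '' (A : Set (W →L[ℂ] ℂ))) :=
  (A.isCompact.image (by fun_prop)).bddAbove

theorem hSupp_le_add_norm_mul_dist (A B : ConvexBody (W →L[ℂ] ℂ)) (u : W) :
    hSupp A (fun ξ => (ξ u).re) ≤ hSupp B (fun ξ => (ξ u).re) + ‖u‖ * dist A B := by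
  refine csSup_le (A.nonempty.image _) ?_
  rintro _ ⟨ξ, hξ, rfl⟩
  obtain ⟨η, hη, hd⟩ := B.isCompact.exists_infDist_eq_dist B.nonempty ξ
  have hle : ‖ξ - η‖ ≤ dist A B := by
    rw [← dist_eq_norm, ← hd, ← ConvexBody.hausdorffDist_coe]
    exact Metric.infDist_le_hausdorffDist_of_mem hξ ConvexBody.hausdorffEDist_ne_top
  have hη_le : (η u).re ≤ hSupp B (fun ξ => (ξ u).re) :=
    le_csSup (bddAbove_image_re_apply B u) ⟨η, hη, rfl⟩
  have hsub : (ξ u).re - (η u).re ≤ ‖u‖ * dist A B := calc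
    (ξ u).re - (η u).re = ((ξ - η) u).re := by simp
    _ ≤ ‖(ξ - η) u‖ := Complex.re_le_norm _
    _ ≤ ‖ξ - η‖ * ‖u‖ := (ξ - η).le_opNorm u
    _ ≤ ‖u‖ * dist A B := by rw [mul_comm]; gcongr
  show (ξ u).re ≤ _
  linarith

theorem abs_hSupp_sub_le (A B : ConvexBody (W →L[ℂ] ℂ)) (u : W) :
    |hSupp A (fun ξ => (ξ u).re) - hSupp B (fun ξ => (ξ u).re)| ≤ ‖u‖ * dist A B := by
  have hAB := hSupp_le_add_norm_mul_dist A B u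
  have hBA := hSupp_le_add_norm_mul_dist B A u
  rw [dist_comm] at hBA
  exact abs_sub_le_iff.2 ⟨by linarith, by linarith⟩

theorem continuous_hSupp :
    Continuous fun p : ConvexBody (W →L[ℂ] ℂ) × W => hSupp p.1 (fun ξ => (ξ p.2).re) := by
  rw [continuous_iff_continuousAt]
  rintro ⟨A, u⟩
  have hdir : Continuous fun v : W => hSupp A (fun ξ => (ξ v).re) :=
    A.isCompact.continuous_sSup (f := fun (v : W) (ξ : W →L[ℂ] ℂ) => (ξ v).re)
      (Complex.continuous_re.comp (continuous_snd.clm_apply continuous_fst))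
  have hlim : Filter.Tendsto
      (fun p : ConvexBody (W →L[ℂ] ℂ) × W => hSupp p.1 (fun ξ => (ξ p.2).re)
        - hSupp A (fun ξ => (ξ p.2).re)) (nhds (A, u)) (nhds 0) := by
    refine squeeze_zero_norm (fun p => abs_hSupp_sub_le p.1 A p.2) ?_
    have : Continuous fun p : ConvexBody (W →L[ℂ] ℂ) × W => ‖p.2‖ * dist p.1 A := by fun_prop
    simpa using this.tendsto (A, u)
  have hA : Filter.Tendsto (fun p : ConvexBody (W →L[ℂ] ℂ) × W => hSupp A (fun ξ => (ξ p.2).re))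
      (nhds (A, u)) (nhds (hSupp A (fun ξ => (ξ u).re))) :=
    (hdir.comp continuous_snd).tendsto (A, u)
  simpa [ContinuousAt] using hlim.add hA

theorem hSupp_mapCLM_precompDual [FiniteDimensional ℂ W] (A : ConvexBody (W →L[ℂ] ℂ))
    (g : W →L[ℂ] W) (u : W) :
    hSupp (A.mapCLM (precompDual g)) (fun ξ => (ξ u).re) = hSupp A (fun ξ => (ξ (g u)).re) :=
  congrArg sSup (Set.image_image _ _ _)

end SupportFunction

section Dilation

theorem ConvexBody.continuous_const_smul {V : Type*} [NormedAddCommGroup V] [NormedSpace ℝ V]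
    (t : ℝ) : Continuous fun K : ConvexBody V => t • K := by
  have hdist (K L : ConvexBody V) {x : V} (hx : x ∈ t • (K : Set V)) :
      ∃ y ∈ t • (L : Set V), dist x y ≤ |t| * dist K L := by
    obtain ⟨x, hx, rfl⟩ := hx
    obtain ⟨y, hy, hd⟩ := L.isCompact.exists_infDist_eq_dist L.nonempty x
    refine ⟨t • y, ⟨y, hy, rfl⟩, ?_⟩
    show dist (t • x) (t • y) ≤ _
    rw [dist_smul₀, ← hd, ← ConvexBody.hausdorffDist_coe, Real.norm_eq_abs]
    gcongr
    exact Metric.infDist_le_hausdorffDist_of_mem hx ConvexBody.hausdorffEDist_ne_top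
  have hlip : LipschitzWith |t|.toNNReal fun K : ConvexBody V => t • K :=
    LipschitzWith.of_dist_le' fun K L =>
      Metric.hausdorffDist_le_of_mem_dist (by positivity) (fun x hx => hdist K L hx)
        fun x hx => by simpa only [dist_comm, ConvexBody.coe_smul] using hdist L K hx
  exact hlip.continuous

theorem ConvexBody.mapCLM_smul {V V' : Type*} [NormedAddCommGroup V] [NormedSpace ℝ V]
    [NormedAddCommGroup V'] [NormedSpace ℝ V'] (φ : V →L[ℝ] V') (t : ℝ) (K : ConvexBody V) :
    (t • K).mapCLM φ = t • K.mapCLM φ :=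
  ConvexBody.ext (Set.image_smul_comm φ t K (map_smul φ t))

/-- The degree two component is recovered by Lagrange interpolation at the dilates
`K, 2K, …, 5K`. -/
theorem degree_two_component_eq_interpolation {V : Type*} [NormedAddCommGroup V] [NormedSpace ℝ V]
    (f : ℕ → ConvexBody V → ℝ) (F : ConvexBody V → ℝ)
    (hf : ∀ (i : ℕ) (K : ConvexBody V) (t : ℝ), 0 < t → f i (t • K) = t ^ i * f i K)
    (hF : ∀ K, F K = ∑ i ∈ Finset.range 5, f i K) (K : ConvexBody V) :
    f 2 K = 71 / 24 * F ((1 : ℝ) • K) - 59 / 6 * F ((2 : ℝ) • K) + 49 / 4 * F ((3 : ℝ) • K)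
      - 41 / 6 * F ((4 : ℝ) • K) + 35 / 24 * F ((5 : ℝ) • K) := by
  simp only [hF, Finset.sum_range_succ, Finset.sum_range_zero]
  have h1 := fun i => hf i K 1 (by norm_num)
  have h2 := fun i => hf i K 2 (by norm_num)
  have h3 := fun i => hf i K 3 (by norm_num)
  have h4 := fun i => hf i K 4 (by norm_num)
  have h5 := fun i => hf i K 5 (by norm_num)
  simp only [h1, h2, h3, h4, h5]
  ring

end Dilation

/-- Lemma 3.1 of the paper. Let `W` be a 2-dimensional complex vector
space, `Z : 𝒦(W) → 𝒦(W*)` a continuous, translation invariant, `SL(W,ℂ)`-contravariant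
Minkowski valuation, and `f 2` its McMullen component of degree `2`. Then
`f₂ : 𝒦(W) × W → ℝ` is continuous and satisfies
`f₂(g K, u) = (det_ℂ g)^{3/2} f₂(K, g⁻¹ u)` for every `g ∈ GL(W,ℂ)` whose complex
determinant is a positive real number `c`, every `K ∈ 𝒦(W)` and every `u ∈ W`. -/
theorem degree_two_component_det_equivariance
    {W : Type*} [NormedAddCommGroup W] [NormedSpace ℂ W] [FiniteDimensional ℂ W]
    (hW : Module.finrank ℂ W = 2)
    (Z : ConvexBody W → ConvexBody (W →L[ℂ] ℂ))
    (hZc : Continuous Z) (hZt : IsTranslationInvariant Z)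
    (hZv : IsMinkowskiValuation Z) (hZg : IsSLContravariant Z)
    (f : ℕ → ConvexBody W → W → ℝ) (hf : McMullenProps f)
    (hsum : ∀ (K : ConvexBody W) (u : W),
      hSupp (Z K) (fun ξ => (ξ u).re) = ∑ i ∈ Finset.range 5, f i K u) :
    Continuous (fun p : ConvexBody W × W => f 2 p.1 p.2) ∧
    ∀ (g : W ≃L[ℂ] W) (c : ℝ), 0 < c →
      LinearMap.det ((g : W →L[ℂ] W) : W →ₗ[ℂ] W) = (c : ℂ) →
      ∀ (K : ConvexBody W) (u : W),
        f 2 (K.mapCLM (cReal (g : W →ₗ[ℂ] W))) u =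
          Real.rpow c (3 / 2) * f 2 K (g.symm u) := by
  obtain ⟨-, -, -, hhom, -, hpos⟩ := hf
  set F : ConvexBody W → W → ℝ := fun K u => hSupp (Z K) (fun ξ => (ξ u).re) with hF
  have hint := fun (K : ConvexBody W) (u : W) =>
    degree_two_component_eq_interpolation (fun i K => f i K u) (fun K => F K u)
      (fun i K t ht => hhom i K u t ht) (fun K => hsum K u) K
  refine ⟨?_, ?_⟩
  · have hc (t : ℝ) : Continuous fun p : ConvexBody W × W => F (t • p.1) p.2 :=
      continuous_hSupp.comp
        ((hZc.comp ((ConvexBody.continuous_const_smul t).comp continuous_fst)).prodMk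
          continuous_snd)
    simp only [hint]
    exact (((((hc 1).const_mul _).sub ((hc 2).const_mul _)).add ((hc 3).const_mul _)).sub
      ((hc 4).const_mul _)).add ((hc 5).const_mul _)
  · have hSL (g : W ≃L[ℂ] W) (hg : LinearMap.det ((g : W →L[ℂ] W) : W →ₗ[ℂ] W) = 1)
        (K : ConvexBody W) (u : W) :
        f 2 (K.mapCLM (cReal (g : W →ₗ[ℂ] W))) u = f 2 K (g.symm u) := by
      have hFg (t : ℝ) : F (t • K.mapCLM (cReal (g : W →ₗ[ℂ] W))) u = F (t • K) (g.symm u) := by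
        rw [← ConvexBody.mapCLM_smul]
        simp only [hF, hZg g hg, hSupp_mapCLM_precompDual]
        rfl
      simp only [hint, hFg]
    intro g c hc hdet K u
    set s : ℝ := √c with hs
    have hs0 : 0 < s := Real.sqrt_pos.2 hc
    have hss : s ^ 2 = c := Real.sq_sqrt hc.le
    have hsC : (s : ℂ) ≠ 0 := by exact_mod_cast hs0.ne'
    let g₀ : W ≃L[ℂ] W := g.trans (ContinuousLinearEquiv.smulLeft (Units.mk0 (s : ℂ) hsC)⁻¹)
    have hg₀ (x : W) : g₀ x = (s : ℂ)⁻¹ • g x := rfl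
    have hg₀symm : g₀.symm u = s • g.symm u := by
      rw [ContinuousLinearEquiv.symm_apply_eq, hg₀, ← Complex.coe_smul, map_smul,
        g.apply_symm_apply, inv_smul_smul₀ hsC]
    have hdet₀ : LinearMap.det ((g₀ : W →L[ℂ] W) : W →ₗ[ℂ] W) = 1 := by
      have : ((g₀ : W →L[ℂ] W) : W →ₗ[ℂ] W) = (s : ℂ)⁻¹ • ((g : W →L[ℂ] W) : W →ₗ[ℂ] W) := rfl
      rw [this, LinearMap.det_smul, hW, hdet, ← hss]
      push_cast
      field_simp
    have hmap : K.mapCLM (cReal (g : W →ₗ[ℂ] W)) = s • K.mapCLM (cReal (g₀ : W →ₗ[ℂ] W)) := by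
      refine ConvexBody.ext ?_
      refine Eq.trans (Set.image_congr fun x _ => ?_) (Set.image_image _ _ _).symm
      show g x = s • g₀ x
      rw [hg₀, ← Complex.coe_smul, smul_inv_smul₀ hsC]
    have hpow : Real.rpow c (3 / 2) = s ^ 3 := by
      rw [hs, Real.sqrt_eq_rpow, ← Real.rpow_mul_natCast hc.le]
      norm_num
    rw [hmap, hhom 2 _ _ _ hs0, hSL g₀ hdet₀, hg₀symm, hpos 2 _ _ _ hs0, hpow]
    ring
end
end
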